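/- Let χ be a fixed smooth function on ℝ with χ(s) = 1 for |s| ≤ 1/2 and χ(s) = 0 for |s| ≥ 1, and let λ₁ ∈ (0,1). For x, x₁ ∈ ℝ² set p = |x−x₁|, r = |x|+1, and F(λ,x,x₁) = χ(λp)Y₀(λp) − χ(λr)Y₀(λr). Then there is a constant C (depending only on χ and λ₁) such that for all λ > 0 and all x, x₁ ∈ ℝ² with x ≠ x₁: |F(λ,x,x₁)| ≤ C k(x,x₁), ∫₀^{2λ₁} ( |F(λ,x,x₁)| + |∂_λ F(λ,x,x₁)| ) dλ ≤ C k(x,x₁), |∂_λ F(λ,x,x₁)| ≤ C/λ, and |∂_λ² F(λ,x,x₁)| ≤ C/λ². -/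

import Mathlib

open MeasureTheory Real Set Filter

noncomputable section

/-- The plane `ℝ²`. -/
abbrev Plane : Type := EuclideanSpace ℝ (Fin 2)

/-- The Bessel function of the second kind of order zero, defined for `z > 0` by the
(improper) integral `Y₀(z) = −(2/π) lim_{T→∞} ∫₀^T cos(z cosh t) dt`. -/
def Y0 (z : ℝ) : ℝ :=
  -(2 / Real.pi) * limUnder atTop (fun T : ℝ => ∫ t in (0:ℝ)..T, Real.cos (z * Real.cosh t))

/-- `log⁻(s) = −log s` for `0 < s < 1`, and `0` otherwise. -/
def logMinus (s : ℝ) : ℝ := if 0 < s ∧ s < 1 then -Real.log s else 0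

/-- `log⁺(s) = log s` for `s > 1`, and `0` otherwise. -/
def logPlus (s : ℝ) : ℝ := if 1 < s then Real.log s else 0

/-- The weight `k(x,x₁) = 1 + log⁻(|x−x₁|) + log⁺(1+|x₁|)`. -/
def kker (x x₁ : Plane) : ℝ := 1 + logMinus ‖x - x₁‖ + logPlus (1 + ‖x₁‖)

/-- `∫₀^∞ sinhⁿ t · exp(−z sinh t) dt`. -/
def sinhMoment (n : ℕ) (z : ℝ) : ℝ :=
  ∫ t in Ioi (0:ℝ), Real.sinh t ^ n * Real.exp (-(z * Real.sinh t))

lemma pow_mul_exp_neg_le (n : ℕ) {c u : ℝ} (hc : 0 < c) (hu : 0 ≤ u) :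
    u ^ n * Real.exp (-(c * u)) ≤ n.factorial / (c / 2) ^ n * Real.exp (-(c / 2 * u)) := by
  have h := Real.pow_div_factorial_le_exp (c / 2 * u) (by positivity) n
  have hf : (0:ℝ) < n.factorial := by positivity
  rw [div_le_iff₀ hf, mul_pow] at h
  have e : Real.exp (-(c * u)) = Real.exp (-(c / 2 * u)) * Real.exp (-(c / 2 * u)) := by
    rw [← Real.exp_add]; ring_nf
  have e2 : Real.exp (c / 2 * u) * Real.exp (-(c / 2 * u)) = 1 := by
    rw [← Real.exp_add]; simp
  have hE := Real.exp_pos (-(c / 2 * u))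
  have hcn : 0 < (c / 2) ^ n := by positivity
  rw [div_mul_eq_mul_div, le_div_iff₀ hcn, e]
  calc u ^ n * (Real.exp (-(c / 2 * u)) * Real.exp (-(c / 2 * u))) * (c / 2) ^ n
      = ((c / 2) ^ n * u ^ n) * Real.exp (-(c / 2 * u)) * Real.exp (-(c / 2 * u)) := by ring
    _ ≤ (Real.exp (c / 2 * u) * n.factorial) * Real.exp (-(c / 2 * u)) *
          Real.exp (-(c / 2 * u)) := by gcongr
    _ = n.factorial * Real.exp (-(c / 2 * u)) * (Real.exp (c / 2 * u) *
          Real.exp (-(c / 2 * u))) := by ring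
    _ = _ := by rw [e2, mul_one]

lemma integrableOn_exp_neg_mul_Ioi {c : ℝ} (hc : 0 < c) :
    IntegrableOn (fun t : ℝ => Real.exp (-(c * t))) (Ioi 0) := by
  simpa [neg_mul] using integrableOn_exp_mul_Ioi (a := -c) (by linarith) 0

lemma integrableOn_sinhMoment (n : ℕ) {z : ℝ} (hz : 0 < z) :
    IntegrableOn (fun t : ℝ => Real.sinh t ^ n * Real.exp (-(z * Real.sinh t))) (Ioi 0) := by
  refine Integrable.mono'
    ((integrableOn_exp_neg_mul_Ioi (half_pos hz)).const_mul (n.factorial / (z / 2) ^ n))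
    (by fun_prop) ?_
  filter_upwards [ae_restrict_mem measurableSet_Ioi] with t ht
  have ht : 0 < t := ht
  have hs : t ≤ Real.sinh t := Real.self_le_sinh_iff.2 ht.le
  have hs0 : 0 ≤ Real.sinh t := ht.le.trans hs
  rw [Real.norm_of_nonneg (by positivity)]
  refine (pow_mul_exp_neg_le n hz hs0).trans ?_
  gcongr

lemma hasDerivAt_sinhMoment (n : ℕ) {z : ℝ} (hz : 0 < z) :
    HasDerivAt (sinhMoment n) (-sinhMoment (n + 1) z) z := by
  have hbound := integrableOn_sinhMoment (n + 1) (half_pos hz)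
  have := (hasDerivAt_integral_of_dominated_loc_of_deriv_le (𝕜 := ℝ)
    (μ := volume.restrict (Ioi (0:ℝ)))
    (F := fun w t => Real.sinh t ^ n * Real.exp (-(w * Real.sinh t)))
    (F' := fun w t => -(Real.sinh t ^ (n + 1) * Real.exp (-(w * Real.sinh t))))
    (x₀ := z) (s := Ioi (z / 2)) (Ioi_mem_nhds (by linarith))
    (bound := fun t => Real.sinh t ^ (n + 1) * Real.exp (-(z / 2 * Real.sinh t)))
    (Eventually.of_forall fun w => by fun_prop)
    (integrableOn_sinhMoment n hz) (by fun_prop) ?_ hbound ?_).2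
  · rw [integral_neg] at this
    exact this
  · filter_upwards [ae_restrict_mem measurableSet_Ioi] with t ht w hw
    have ht : 0 < t := ht
    have hw : z / 2 < w := hw
    have hs0 : 0 ≤ Real.sinh t := ht.le.trans (Real.self_le_sinh_iff.2 ht.le)
    rw [norm_neg, Real.norm_of_nonneg (by positivity)]
    gcongr
  · refine Eventually.of_forall fun t w _ => ?_
    have h := (((hasDerivAt_id w).mul_const (Real.sinh t)).neg.exp).const_mul (Real.sinh t ^ n)
    refine h.congr_deriv ?_
    simp; ring

lemma sinhMoment_nonneg (n : ℕ) (z : ℝ) : 0 ≤ sinhMoment n z := by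
  refine setIntegral_nonneg measurableSet_Ioi fun t ht => ?_
  have hs0 : 0 ≤ Real.sinh t := Real.sinh_nonneg_iff.2 (le_of_lt ht)
  positivity

lemma sinhMoment_zero_le {z : ℝ} (hz : 0 < z) : sinhMoment 0 z ≤ 1 / z := by
  have h1 : ∫ t in Ioi (0:ℝ), Real.exp (-(z * t)) = 1 / z := by
    have := integral_exp_mul_Ioi (a := -z) (by linarith) 0
    simpa [neg_mul, neg_div_neg_eq] using this
  rw [← h1]
  refine setIntegral_mono_on (integrableOn_sinhMoment 0 hz)
    (integrableOn_exp_neg_mul_Ioi hz) measurableSet_Ioi fun t ht => ?_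
  have ht : 0 < t := ht
  have hs : t ≤ Real.sinh t := Real.self_le_sinh_iff.2 ht.le
  rw [pow_zero, one_mul]
  gcongr

lemma tendsto_sinh_atTop : Tendsto Real.sinh atTop atTop := by
  refine tendsto_atTop_mono' _ ?_ tendsto_id
  filter_upwards [eventually_ge_atTop 0] with t ht using Real.self_le_sinh_iff.2 ht

lemma integral_cosh_mul_exp_neg_sinh {z : ℝ} (hz : 0 < z) :
    IntegrableOn (fun t : ℝ => Real.cosh t * Real.exp (-(z * Real.sinh t))) (Ioi 0) ∧
    ∫ t in Ioi (0:ℝ), Real.cosh t * Real.exp (-(z * Real.sinh t)) = 1 / z := by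
  have hd : ∀ t ∈ Ici (0:ℝ), HasDerivAt (fun t => -(Real.exp (-(z * Real.sinh t)) / z))
      (Real.cosh t * Real.exp (-(z * Real.sinh t))) t := fun t _ => by
    have h := ((((Real.hasDerivAt_sinh t).const_mul z).neg.exp).div_const z).neg
    refine h.congr_deriv ?_
    simp only [Pi.neg_apply]
    field_simp
  have hlim : Tendsto (fun t => -(Real.exp (-(z * Real.sinh t)) / z)) atTop (nhds 0) := by
    have h2 := (Real.tendsto_exp_neg_atTop_nhds_zero.comp
      (tendsto_sinh_atTop.const_mul_atTop hz)).div_const z |>.neg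
    simpa using h2
  have hnn : ∀ t ∈ Ioi (0:ℝ), 0 ≤ Real.cosh t * Real.exp (-(z * Real.sinh t)) := fun t _ => by
    have := Real.cosh_pos t
    positivity
  refine ⟨integrableOn_Ioi_deriv_of_nonneg' hd hnn hlim, ?_⟩
  rw [integral_Ioi_of_hasDerivAt_of_nonneg' hd hnn hlim]
  simp

lemma abs_sinhMoment_one_sub_le {z : ℝ} (hz : 0 < z) : |sinhMoment 1 z - 1 / z| ≤ 1 := by
  obtain ⟨hi, hv⟩ := integral_cosh_mul_exp_neg_sinh hz
  have hE := integrableOn_exp_neg_mul_Ioi one_pos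
  have h1 : ∫ t in Ioi (0:ℝ), Real.exp (-(1 * t)) = 1 := by simpa using integral_exp_neg_Ioi_zero
  rw [← hv, sinhMoment, ← integral_sub (integrableOn_sinhMoment 1 hz) hi, ← h1]
  refine norm_integral_le_of_norm_le (G := ℝ) hE ?_
  filter_upwards [ae_restrict_mem measurableSet_Ioi] with t ht
  have ht : 0 < t := ht
  have hs0 : 0 ≤ Real.sinh t := Real.sinh_nonneg_iff.2 ht.le
  have e : Real.sinh t ^ 1 * Real.exp (-(z * Real.sinh t)) -
      Real.cosh t * Real.exp (-(z * Real.sinh t)) =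
      -(Real.exp (-t) * Real.exp (-(z * Real.sinh t))) := by
    rw [← Real.cosh_sub_sinh t]; ring
  rw [e, norm_neg, Real.norm_of_nonneg (by positivity), one_mul]
  refine mul_le_of_le_one_right (Real.exp_pos _).le (Real.exp_le_one_iff.2 ?_)
  have : 0 ≤ z * Real.sinh t := by positivity
  linarith

lemma sinhMoment_two_le {z : ℝ} (hz : 0 < z) : sinhMoment 2 z ≤ 8 / z ^ 2 := by
  obtain ⟨hi, hv⟩ := integral_cosh_mul_exp_neg_sinh (half_pos hz)
  have e8 : 8 / z ^ 2 = 4 / z * (1 / (z / 2)) := by field_simp; norm_num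
  rw [e8, ← hv, ← integral_const_mul]
  refine setIntegral_mono_on (integrableOn_sinhMoment 2 hz) (hi.const_mul _)
    measurableSet_Ioi fun t ht => ?_
  have hs0 : 0 ≤ Real.sinh t := Real.sinh_nonneg_iff.2 (le_of_lt ht)
  have hsc : Real.sinh t ≤ Real.cosh t := (Real.sinh_lt_cosh t).le
  have h := pow_mul_exp_neg_le 1 hz hs0
  calc Real.sinh t ^ 2 * Real.exp (-(z * Real.sinh t))
      = Real.sinh t * (Real.sinh t ^ 1 * Real.exp (-(z * Real.sinh t))) := by ring
    _ ≤ Real.cosh t * ((Nat.factorial 1) / (z / 2) ^ 1 * Real.exp (-(z / 2 * Real.sinh t))) := by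
        gcongr
    _ = 2 / z * (Real.cosh t * Real.exp (-(z / 2 * Real.sinh t))) := by
        simp; ring
    _ ≤ _ := by
        have := Real.cosh_pos t
        gcongr
        norm_num

/-- `∫₀^{π/2} sin(z cos θ) dθ`. -/
def struveIntegral (z : ℝ) : ℝ := ∫ θ in (0:ℝ)..(Real.pi / 2), Real.sin (z * Real.cos θ)

/-- The derivative of `struveIntegral`. -/
def struveIntegral' (z : ℝ) : ℝ :=
  ∫ θ in (0:ℝ)..(Real.pi / 2), Real.cos θ * Real.cos (z * Real.cos θ)

/-- The second derivative of `struveIntegral`. -/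
def struveIntegral'' (z : ℝ) : ℝ :=
  ∫ θ in (0:ℝ)..(Real.pi / 2), -(Real.cos θ ^ 2 * Real.sin (z * Real.cos θ))

lemma hasDerivAt_struveIntegral (z : ℝ) :
    HasDerivAt struveIntegral (struveIntegral' z) z := by
  refine (intervalIntegral.hasDerivAt_integral_of_dominated_loc_of_deriv_le (𝕜 := ℝ)
    (F := fun w θ => Real.sin (w * Real.cos θ))
    (F' := fun w θ => Real.cos θ * Real.cos (w * Real.cos θ))
    (x₀ := z) (s := univ) univ_mem (bound := fun _ => 1)
    (Eventually.of_forall fun w => by fun_prop)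
    (Continuous.intervalIntegrable (by fun_prop) _ _) (by fun_prop) ?_
    (by simp) ?_).2
  · refine Eventually.of_forall fun t _ w _ => ?_
    rw [norm_mul]
    exact mul_le_one₀ (Real.abs_cos_le_one _) (norm_nonneg _) (Real.abs_cos_le_one _)
  · refine Eventually.of_forall fun t _ w _ => ?_
    have h := ((hasDerivAt_id w).mul_const (Real.cos t)).sin
    refine h.congr_deriv ?_
    simp; ring

lemma hasDerivAt_struveIntegral' (z : ℝ) :
    HasDerivAt struveIntegral' (struveIntegral'' z) z := by
  refine (intervalIntegral.hasDerivAt_integral_of_dominated_loc_of_deriv_le (𝕜 := ℝ)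
    (F := fun w θ => Real.cos θ * Real.cos (w * Real.cos θ))
    (F' := fun w θ => -(Real.cos θ ^ 2 * Real.sin (w * Real.cos θ)))
    (x₀ := z) (s := univ) univ_mem (bound := fun _ => 1)
    (Eventually.of_forall fun w => by fun_prop)
    (Continuous.intervalIntegrable (by fun_prop) _ _) (by fun_prop) ?_
    (by simp) ?_).2
  · refine Eventually.of_forall fun t _ w _ => ?_
    rw [norm_neg, norm_mul, norm_pow]
    exact mul_le_one₀ (pow_le_one₀ (norm_nonneg _) (Real.abs_cos_le_one _)) (norm_nonneg _)
      (Real.abs_sin_le_one _)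
  · refine Eventually.of_forall fun t _ w _ => ?_
    have h := (((hasDerivAt_id w).mul_const (Real.cos t)).cos).const_mul (Real.cos t)
    refine h.congr_deriv ?_
    simp; ring

lemma abs_struveIntegral_le (z : ℝ) : |struveIntegral z| ≤ Real.pi / 2 := by
  have := intervalIntegral.norm_integral_le_of_norm_le_const (a := 0) (b := Real.pi / 2) (C := 1)
    (f := fun θ => Real.sin (z * Real.cos θ)) fun t _ => Real.abs_sin_le_one _
  rwa [sub_zero, one_mul, abs_of_pos (by positivity)] at this

lemma abs_struveIntegral'_le (z : ℝ) : |struveIntegral' z| ≤ Real.pi / 2 := by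
  have := intervalIntegral.norm_integral_le_of_norm_le_const (a := 0) (b := Real.pi / 2) (C := 1)
    (f := fun θ => Real.cos θ * Real.cos (z * Real.cos θ)) fun t _ => by
      rw [norm_mul]
      exact mul_le_one₀ (Real.abs_cos_le_one _) (norm_nonneg _) (Real.abs_cos_le_one _)
  rwa [sub_zero, one_mul, abs_of_pos (by positivity)] at this

lemma abs_struveIntegral''_le (z : ℝ) : |struveIntegral'' z| ≤ Real.pi / 2 := by
  have := intervalIntegral.norm_integral_le_of_norm_le_const (a := 0) (b := Real.pi / 2) (C := 1)
    (f := fun θ => -(Real.cos θ ^ 2 * Real.sin (z * Real.cos θ))) fun t _ => by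
      rw [norm_neg, norm_mul, norm_pow]
      exact mul_le_one₀ (pow_le_one₀ (norm_nonneg _) (Real.abs_cos_le_one _)) (norm_nonneg _)
        (Real.abs_sin_le_one _)
  rwa [sub_zero, one_mul, abs_of_pos (by positivity)] at this

lemma Complex.cosh_add_mul_I_eq (x y : ℝ) :
    Complex.cosh (x + y * Complex.I) =
      (Real.cosh x * Real.cos y : ℝ) + (Real.sinh x * Real.sin y : ℝ) * Complex.I := by
  rw [Complex.cosh_add, Complex.cosh_mul_I, Complex.sinh_mul_I]
  push_cast
  ring

lemma norm_exp_I_mul_cosh (z x y : ℝ) :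
    ‖Complex.exp (Complex.I * z * Complex.cosh (x + y * Complex.I))‖ =
      Real.exp (-(z * (Real.sinh x * Real.sin y))) := by
  rw [Complex.norm_exp, Complex.cosh_add_mul_I_eq]
  congr 1
  simp [-Complex.ofReal_cosh, -Complex.ofReal_sinh, -Complex.ofReal_mul]

lemma tendsto_integral_exp_I_mul_cosh {z : ℝ} (hz : 0 < z) :
    Tendsto (fun T : ℝ => ∫ y in (0:ℝ)..(Real.pi / 2),
      Complex.exp (Complex.I * z * Complex.cosh (T + y * Complex.I))) atTop (nhds 0) := by
  have hpi := Real.pi_pos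
  have := intervalIntegral.tendsto_integral_filter_of_dominated_convergence
    (μ := volume) (a := 0) (b := Real.pi / 2) (l := atTop)
    (F := fun (T y : ℝ) => Complex.exp (Complex.I * z * Complex.cosh (T + y * Complex.I)))
    (f := fun _ => 0) (fun _ => (1:ℝ)) (Eventually.of_forall fun T => by fun_prop) ?_ (by simp) ?_
  · simpa using this
  · filter_upwards [eventually_ge_atTop 0] with T hT
    refine Eventually.of_forall fun y hy => ?_
    rw [uIoc_of_le (by positivity)] at hy
    rw [norm_exp_I_mul_cosh, Real.exp_le_one_iff]
    have h1 : 0 ≤ Real.sinh T := Real.sinh_nonneg_iff.2 hT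
    have h2 : 0 ≤ Real.sin y := Real.sin_nonneg_of_nonneg_of_le_pi hy.1.le (by linarith [hy.2])
    have : 0 ≤ z * (Real.sinh T * Real.sin y) := by positivity
    linarith
  · refine Eventually.of_forall fun y hy => ?_
    rw [uIoc_of_le (by positivity)] at hy
    have h2 : 0 < Real.sin y := Real.sin_pos_of_pos_of_lt_pi hy.1 (by linarith [hy.2])
    rw [tendsto_zero_iff_norm_tendsto_zero]
    simp only [norm_exp_I_mul_cosh]
    exact Real.tendsto_exp_neg_atTop_nhds_zero.comp
      ((tendsto_sinh_atTop.atTop_mul_const h2).const_mul_atTop hz)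

lemma integral_cos_mul_cosh_eq (z T : ℝ) :
    ∫ t in (0:ℝ)..T, Real.cos (z * Real.cosh t) =
      (∫ t in (0:ℝ)..T, Real.exp (-(z * Real.sinh t))) - struveIntegral z
        + (∫ y in (0:ℝ)..(Real.pi / 2),
            Complex.exp (Complex.I * z * Complex.cosh (T + y * Complex.I))).im := by
  have hC := Complex.integral_boundary_rect_eq_zero_of_differentiableOn
    (fun w => Complex.exp (Complex.I * z * Complex.cosh w)) 0 (T + (Real.pi / 2 : ℝ) * Complex.I)
    (by fun_prop)
  simp only [Complex.zero_re, Complex.zero_im, Complex.add_re, Complex.add_im, Complex.ofReal_re,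
    Complex.ofReal_im, Complex.re_ofReal_mul, Complex.im_ofReal_mul, Complex.I_re, Complex.I_im,
    mul_zero, mul_one, add_zero, zero_add, Complex.ofReal_zero, zero_mul, smul_eq_mul] at hC
  have h1 : (∫ x in (0:ℝ)..T, Complex.exp (Complex.I * z * Complex.cosh x)).re =
      ∫ t in (0:ℝ)..T, Real.cos (z * Real.cosh t) := by
    rw [← Complex.reCLM_apply, ← ContinuousLinearMap.intervalIntegral_comp_comm]
    · refine intervalIntegral.integral_congr fun t _ => ?_
      simp only [Complex.reCLM_apply]
      rw [Complex.exp_re, ← Complex.ofReal_cosh]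
      simp [-Complex.ofReal_cosh]
    · exact Continuous.intervalIntegrable (by fun_prop) _ _
  have h2 : (∫ x in (0:ℝ)..T, Complex.exp (Complex.I * z *
      Complex.cosh (x + (Real.pi / 2 : ℝ) * Complex.I))).re =
      ∫ t in (0:ℝ)..T, Real.exp (-(z * Real.sinh t)) := by
    rw [← Complex.reCLM_apply, ← ContinuousLinearMap.intervalIntegral_comp_comm]
    · refine intervalIntegral.integral_congr fun t _ => ?_
      simp only [Complex.reCLM_apply]
      rw [Complex.exp_re, Complex.cosh_add_mul_I_eq]
      simp [-Complex.ofReal_cosh, -Complex.ofReal_sinh]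
    · exact Continuous.intervalIntegrable (by fun_prop) _ _
  have h3 : (∫ y in (0:ℝ)..(Real.pi / 2), Complex.exp (Complex.I * z *
      Complex.cosh (y * Complex.I))).im = struveIntegral z := by
    rw [← Complex.imCLM_apply, ← ContinuousLinearMap.intervalIntegral_comp_comm]
    · refine intervalIntegral.integral_congr fun t _ => ?_
      simp only [Complex.imCLM_apply]
      rw [Complex.exp_im, Complex.cosh_mul_I, ← Complex.ofReal_cos]
      simp [-Complex.ofReal_cos]
    · exact Continuous.intervalIntegrable (by fun_prop) _ _
  have hre := congrArg Complex.re hC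
  simp only [Complex.sub_re, Complex.add_re, Complex.I_mul_re, Complex.zero_re] at hre
  rw [h1, h2, h3] at hre
  linarith

lemma Y0_eq {z : ℝ} (hz : 0 < z) :
    Y0 z = 2 / Real.pi * (struveIntegral z - sinhMoment 0 z) := by
  have hK : Tendsto (fun T : ℝ => ∫ t in (0:ℝ)..T, Real.exp (-(z * Real.sinh t))) atTop
      (nhds (sinhMoment 0 z)) := by
    have hi := integrableOn_sinhMoment 0 hz
    simp only [pow_zero, one_mul] at hi
    simpa [sinhMoment] using intervalIntegral_tendsto_integral_Ioi 0 hi tendsto_id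
  have hR := (Complex.continuous_im.tendsto _).comp (tendsto_integral_exp_I_mul_cosh hz)
  have hL : Tendsto (fun T : ℝ => ∫ t in (0:ℝ)..T, Real.cos (z * Real.cosh t)) atTop
      (nhds (sinhMoment 0 z - struveIntegral z)) := by
    have := (hK.sub_const (struveIntegral z)).add hR
    rw [Complex.zero_im, add_zero] at this
    exact this.congr fun T => (integral_cos_mul_cosh_eq z T).symm
  rw [Y0, hL.limUnder_eq]
  ring

/-- The derivative of `Y0` on `(0, ∞)`. -/
def Y0' (z : ℝ) : ℝ := 2 / Real.pi * (struveIntegral' z + sinhMoment 1 z)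

/-- The second derivative of `Y0` on `(0, ∞)`. -/
def Y0'' (z : ℝ) : ℝ := 2 / Real.pi * (struveIntegral'' z - sinhMoment 2 z)

lemma hasDerivAt_Y0 {z : ℝ} (hz : 0 < z) : HasDerivAt Y0 (Y0' z) z := by
  have h := ((hasDerivAt_struveIntegral z).sub (hasDerivAt_sinhMoment 0 hz)).const_mul
    (2 / Real.pi)
  rw [sub_neg_eq_add] at h
  refine h.congr_of_eventuallyEq ?_
  filter_upwards [Ioi_mem_nhds hz] with w hw using Y0_eq hw

lemma hasDerivAt_Y0' {z : ℝ} (hz : 0 < z) : HasDerivAt Y0' (Y0'' z) z := by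
  have h := ((hasDerivAt_struveIntegral' z).add (hasDerivAt_sinhMoment 1 hz)).const_mul
    (2 / Real.pi)
  rwa [← sub_eq_add_neg] at h

lemma two_div_pi_le_one : 2 / Real.pi ≤ 1 := by
  rw [div_le_one Real.pi_pos]; exact Real.two_le_pi

lemma abs_Y0_le {z : ℝ} (hz : 0 < z) : |Y0 z| ≤ 2 + 1 / z := by
  have hpi := Real.pi_pos
  rw [Y0_eq hz, abs_mul, abs_of_pos (by positivity)]
  have h1 := abs_le.1 (abs_struveIntegral_le z)
  have h2 := sinhMoment_zero_le hz
  have h3 := sinhMoment_nonneg 0 z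
  have h4 : |struveIntegral z - sinhMoment 0 z| ≤ 2 + 1 / z := by
    rw [abs_le]; constructor <;> linarith [Real.pi_le_four]
  exact (mul_le_of_le_one_left (abs_nonneg _) two_div_pi_le_one).trans h4

lemma abs_Y0'_sub_le {z : ℝ} (hz : 0 < z) : |Y0' z - 2 / Real.pi * (1 / z)| ≤ 3 := by
  have hpi := Real.pi_pos
  rw [Y0', ← mul_sub, abs_mul, abs_of_pos (by positivity)]
  have h1 := abs_le.1 (abs_struveIntegral'_le z)
  have h2 := abs_le.1 (abs_sinhMoment_one_sub_le hz)
  have h4 : |struveIntegral' z + sinhMoment 1 z - 1 / z| ≤ 3 := by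
    rw [abs_le]; constructor <;> linarith [Real.pi_le_four]
  exact (mul_le_of_le_one_left (abs_nonneg _) two_div_pi_le_one).trans h4

lemma abs_Y0''_le {z : ℝ} (hz : 0 < z) : |Y0'' z| ≤ 2 + 8 / z ^ 2 := by
  have hpi := Real.pi_pos
  rw [Y0'', abs_mul, abs_of_pos (by positivity)]
  have h1 := abs_le.1 (abs_struveIntegral''_le z)
  have h2 := sinhMoment_two_le hz
  have h3 := sinhMoment_nonneg 2 z
  have h4 : |struveIntegral'' z - sinhMoment 2 z| ≤ 2 + 8 / z ^ 2 := by
    rw [abs_le]; constructor <;> linarith [Real.pi_le_four]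
  exact (mul_le_of_le_one_left (abs_nonneg _) two_div_pi_le_one).trans h4

/-- Size and differentiability properties of the cut-off Bessel function: `g' , g''` are the first
two derivatives of `g` on `(0, ∞)`, with the growth of the derivatives of `c · log` near `0`,
and `g'` vanishes beyond `1`. -/
structure LogLike (g g' g'' : ℝ → ℝ) (c B : ℝ) : Prop where
  hasDerivAt : ∀ s, 0 < s → HasDerivAt g (g' s) s
  hasDerivAt' : ∀ s, 0 < s → HasDerivAt g' (g'' s) s
  abs_deriv_le : ∀ s, 0 < s → |g' s| ≤ B / s
  abs_mul_deriv_sub_le : ∀ s, 0 < s → |s * g' s - c| ≤ B * s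
  abs_deriv2_le : ∀ s, 0 < s → |g'' s| ≤ B / s ^ 2
  deriv_eq_zero : ∀ s, 1 < s → g' s = 0

lemma exists_logLike_cutoff {χ : ℝ → ℝ} (hχ : ContDiff ℝ (⊤ : ℕ∞) χ)
    (hχ1 : ∀ s : ℝ, |s| ≤ 1 / 2 → χ s = 1) (hχ0 : ∀ s : ℝ, 1 ≤ |s| → χ s = 0) :
    ∃ g' g'' : ℝ → ℝ, ∃ B : ℝ, 0 < B ∧
      LogLike (fun s => χ s * Y0 s) g' g'' (2 / Real.pi) B := by
  have hd1 : ContDiff ℝ (⊤ : ℕ∞) (deriv χ) := (contDiff_infty_iff_deriv.1 hχ).2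
  have hd2 : ContDiff ℝ (⊤ : ℕ∞) (deriv (deriv χ)) := (contDiff_infty_iff_deriv.1 hd1).2
  have hcs : HasCompactSupport χ := by
    refine HasCompactSupport.intro (K := Icc (-1) 1) isCompact_Icc fun s hs => hχ0 s ?_
    by_contra! h
    exact hs (abs_le.1 h.le)
  obtain ⟨M0, hM0⟩ := hcs.exists_bound_of_continuous hχ.continuous
  obtain ⟨M1, hM1⟩ := hcs.deriv.exists_bound_of_continuous hd1.continuous
  obtain ⟨M2, hM2⟩ := hcs.deriv.deriv.exists_bound_of_continuous hd2.continuous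
  have hpM0 : 0 ≤ M0 := (abs_nonneg _).trans (hM0 0)
  have hpM1 : 0 ≤ M1 := (abs_nonneg _).trans (hM1 0)
  have hpM2 : 0 ≤ M2 := (abs_nonneg _).trans (hM2 0)
  have hD1 : ∀ s, HasDerivAt χ (deriv χ s) s := fun s =>
    (hχ.differentiable (by simp) s).hasDerivAt
  have hD2 : ∀ s, HasDerivAt (deriv χ) (deriv (deriv χ) s) s := fun s =>
    (hd1.differentiable (by simp) s).hasDerivAt
  have hsmall : ∀ s, 0 < s → s < 1 / 2 → χ s = 1 ∧ deriv χ s = 0 ∧ deriv (deriv χ) s = 0 := by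
    have h1 : ∀ s, 0 < s → s < 1 / 2 → deriv χ s = 0 := fun s hs hs' => by
      have : χ =ᶠ[nhds s] fun _ => 1 := by
        filter_upwards [Ioo_mem_nhds hs hs'] with t ht
        exact hχ1 t (by rw [abs_of_pos ht.1]; exact ht.2.le)
      rw [this.deriv_eq, deriv_const]
    refine fun s hs hs' => ⟨hχ1 s (by rw [abs_of_pos hs]; exact hs'.le), h1 s hs hs', ?_⟩
    have : deriv χ =ᶠ[nhds s] fun _ => 0 := by
      filter_upwards [Ioo_mem_nhds hs hs'] with t ht using h1 t ht.1 ht.2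
    rw [this.deriv_eq, deriv_const]
  have hlarge : ∀ s, 1 < s → χ s = 0 ∧ deriv χ s = 0 ∧ deriv (deriv χ) s = 0 := by
    have h0 : ∀ s, 1 < s → χ s = 0 := fun s hs => hχ0 s (by
      rw [abs_of_pos (by linarith)]; exact hs.le)
    have h1 : ∀ s, 1 < s → deriv χ s = 0 := fun s hs => by
      have : χ =ᶠ[nhds s] fun _ => 0 := by
        filter_upwards [Ioi_mem_nhds hs] with t ht using h0 t ht
      rw [this.deriv_eq, deriv_const]
    refine fun s hs => ⟨h0 s hs, h1 s hs, ?_⟩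
    have : deriv χ =ᶠ[nhds s] fun _ => 0 := by
      filter_upwards [Ioi_mem_nhds hs] with t ht using h1 t ht
    rw [this.deriv_eq, deriv_const]
  have hc0 : 0 < 2 / Real.pi := by have := Real.pi_pos; positivity
  have hc1 := two_div_pi_le_one
  have hY' : ∀ s, 0 < s → |Y0' s| ≤ 3 + 1 / s := fun s hs => by
    have h := abs_le.1 (abs_Y0'_sub_le hs)
    have hs' : 0 < 1 / s := by positivity
    rw [abs_le]
    constructor <;> nlinarith
  refine ⟨fun s => deriv χ s * Y0 s + χ s * Y0' s,
    fun s => deriv (deriv χ) s * Y0 s + 2 * (deriv χ s * Y0' s) + χ s * Y0'' s,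
    20 + 4 * M2 + 20 * M1 + 40 * M0, by positivity, ?_⟩
  have key1 : ∀ s, 0 < s → |s * (deriv χ s * Y0 s + χ s * Y0' s) - 2 / Real.pi| ≤
      (10 + 4 * M1 + 10 * M0) * s := by
    intro s hs
    have hb := abs_Y0'_sub_le hs
    rcases lt_or_ge s (1 / 2) with h | h
    · obtain ⟨e0, e1, -⟩ := hsmall s hs h
      have e : s * (deriv χ s * Y0 s + χ s * Y0' s) - 2 / Real.pi =
          s * (Y0' s - 2 / Real.pi * (1 / s)) := by
        rw [e0, e1]; field_simp; ring
      rw [e, abs_mul, abs_of_pos hs]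
      nlinarith [mul_nonneg hpM1 hs.le, mul_nonneg hpM0 hs.le]
    · have hi : 1 / s ≤ 2 := by rw [div_le_iff₀ hs]; linarith
      have a0 : |χ s * Y0' s| ≤ M0 * 5 := by
        rw [abs_mul]
        exact mul_le_mul (hM0 s) ((hY' s hs).trans (by linarith)) (abs_nonneg _) hpM0
      have a1 : |deriv χ s * Y0 s| ≤ M1 * 4 := by
        rw [abs_mul]
        exact mul_le_mul (hM1 s) ((abs_Y0_le hs).trans (by linarith)) (abs_nonneg _) hpM1
      have a2 : |deriv χ s * Y0 s + χ s * Y0' s| ≤ M1 * 4 + M0 * 5 :=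
        (abs_add_le _ _).trans (add_le_add a1 a0)
      calc |s * (deriv χ s * Y0 s + χ s * Y0' s) - 2 / Real.pi|
          ≤ |s * (deriv χ s * Y0 s + χ s * Y0' s)| + |2 / Real.pi| := abs_sub _ _
        _ ≤ s * (M1 * 4 + M0 * 5) + 1 := by
            rw [abs_mul, abs_of_pos hs, abs_of_pos hc0]; gcongr
        _ ≤ _ := by nlinarith
  refine ⟨fun s hs => (hD1 s).mul (hasDerivAt_Y0 hs), fun s hs => ?_, fun s hs => ?_,
    fun s hs => ?_, fun s hs => ?_, fun s hs => ?_⟩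
  · refine (((hD2 s).mul (hasDerivAt_Y0 hs)).add ((hD1 s).mul (hasDerivAt_Y0' hs))).congr_deriv ?_
    ring
  · rcases le_or_gt s 1 with h | h
    · rw [le_div_iff₀ hs]
      have k := abs_le.1 (key1 s hs)
      rw [mul_comm, ← abs_of_pos hs, ← abs_mul, abs_of_pos hs, abs_le]
      constructor <;> nlinarith
    · obtain ⟨e0, e1, -⟩ := hlarge s h
      simp only [e0, e1, zero_mul, add_zero, abs_zero]
      positivity
  · refine (key1 s hs).trans ?_
    gcongr <;> linarith
  · rcases le_or_gt s 1 with h | h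
    · have hs2 : s ^ 2 ≤ 1 := by nlinarith
      have hY2 : |Y0'' s| * s ^ 2 ≤ 10 := by
        have := mul_le_mul_of_nonneg_right (abs_Y0''_le hs) (sq_nonneg s)
        have e : (2 + 8 / s ^ 2) * s ^ 2 = 2 * s ^ 2 + 8 := by field_simp
        linarith
      have hY1 : |Y0' s| * s ^ 2 ≤ 4 := by
        have := mul_le_mul_of_nonneg_right (hY' s hs) (sq_nonneg s)
        have e : (3 + 1 / s) * s ^ 2 = 3 * s ^ 2 + s := by field_simp
        linarith
      have hY0 : |Y0 s| * s ^ 2 ≤ 3 := by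
        have := mul_le_mul_of_nonneg_right (abs_Y0_le hs) (sq_nonneg s)
        have e : (2 + 1 / s) * s ^ 2 = 2 * s ^ 2 + s := by field_simp
        linarith
      rw [le_div_iff₀ (by positivity)]
      have t2 : |deriv (deriv χ) s * Y0 s| * s ^ 2 ≤ M2 * 3 := by
        rw [abs_mul, mul_assoc]
        exact mul_le_mul (hM2 s) hY0 (by positivity) hpM2
      have t1 : |2 * (deriv χ s * Y0' s)| * s ^ 2 ≤ 2 * (M1 * 4) := by
        rw [abs_mul, abs_mul, abs_two, mul_assoc, mul_assoc]
        exact mul_le_mul_of_nonneg_left (mul_le_mul (hM1 s) hY1 (by positivity) hpM1) two_pos.le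
      have t0 : |χ s * Y0'' s| * s ^ 2 ≤ M0 * 10 := by
        rw [abs_mul, mul_assoc]
        exact mul_le_mul (hM0 s) hY2 (by positivity) hpM0
      have := mul_le_mul_of_nonneg_right
        (abs_add_three (deriv (deriv χ) s * Y0 s) (2 * (deriv χ s * Y0' s)) (χ s * Y0'' s))
        (sq_nonneg s)
      linarith
    · obtain ⟨e0, e1, e2⟩ := hlarge s h
      simp only [e0, e1, e2, zero_mul, mul_zero, add_zero, abs_zero]
      positivity
  · obtain ⟨e0, e1, -⟩ := hlarge s hs
    simp [e0, e1]

namespace LogLike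

variable {g g' g'' : ℝ → ℝ} {c B : ℝ}

lemma abs_sub_le (h : LogLike g g' g'' c B) {u v : ℝ} (hu : 0 < u) (hv : 0 < v) :
    |g u - g v| ≤ B * |Real.log (u / v)| := by
  have main : ∀ u v : ℝ, 0 < u → u ≤ v → |g v - g u| ≤ B * |Real.log (v / u)| := by
    intro u v hu huv
    have hv := hu.trans_le huv
    have hmem : ∀ x ∈ uIcc u v, 0 < x := fun x hx => by
      rw [uIcc_of_le huv] at hx; exact hu.trans_le hx.1
    have hcont : ContinuousOn g' (uIcc u v) := fun x hx =>
      (h.hasDerivAt' x (hmem x hx)).continuousAt.continuousWithinAt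
    rw [← intervalIntegral.integral_eq_sub_of_hasDerivAt
      (fun x hx => h.hasDerivAt x (hmem x hx)) hcont.intervalIntegrable]
    have hB : IntervalIntegrable (fun s : ℝ => B * s⁻¹) volume u v :=
      (intervalIntegral.intervalIntegrable_inv (fun x hx => (hmem x hx).ne')
        continuousOn_id).const_mul B
    have := intervalIntegral.norm_integral_le_of_norm_le huv (f := g') (μ := volume)
      (g := fun s => B * s⁻¹) (Eventually.of_forall fun s hs => by
        simpa [div_eq_mul_inv] using h.abs_deriv_le s (hu.trans hs.1)) hB
    rw [intervalIntegral.integral_const_mul, integral_inv_of_pos hu hv] at this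
    rwa [abs_of_nonneg (Real.log_nonneg ((one_le_div hu).2 huv))]
  rcases le_total u v with huv | huv
  · rw [abs_sub_comm, ← inv_div v u, Real.log_inv, abs_neg]
    exact main u v hu huv
  · exact main v u hv huv

lemma hasDerivAt_dilation_sub (h : LogLike g g' g'' c B) {a b l : ℝ} (ha : 0 < a) (hb : 0 < b)
    (hl : 0 < l) : HasDerivAt (fun s => g (s * a) - g (s * b))
      (a * g' (l * a) - b * g' (l * b)) l := by
  have d : ∀ a, 0 < a → HasDerivAt (fun s => g (s * a)) (a * g' (l * a)) l := fun a ha => by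
    have := (h.hasDerivAt (l * a) (by positivity)).comp l ((hasDerivAt_id l).mul_const a)
    refine this.congr_deriv ?_
    ring
  exact (d a ha).sub (d b hb)

lemma hasDerivAt_dilation_sub' (h : LogLike g g' g'' c B) {a b l : ℝ} (ha : 0 < a) (hb : 0 < b)
    (hl : 0 < l) : HasDerivAt (fun s => a * g' (s * a) - b * g' (s * b))
      (a ^ 2 * g'' (l * a) - b ^ 2 * g'' (l * b)) l := by
  have d : ∀ a, 0 < a → HasDerivAt (fun s => a * g' (s * a)) (a ^ 2 * g'' (l * a)) l :=
    fun a ha => by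
      have := ((h.hasDerivAt' (l * a) (by positivity)).comp l
        ((hasDerivAt_id l).mul_const a)).const_mul a
      refine this.congr_deriv ?_
      ring
  exact (d a ha).sub (d b hb)

lemma abs_deriv_dilation_sub_le (h : LogLike g g' g'' c B) {a b l : ℝ} (ha : 0 < a) (hb : 0 < b)
    (hl : 0 < l) : |deriv (fun s => g (s * a) - g (s * b)) l| ≤ 2 * B / l := by
  rw [(h.hasDerivAt_dilation_sub ha hb hl).deriv]
  have d : ∀ a, 0 < a → |a * g' (l * a)| ≤ B / l := fun a ha => by
    rw [abs_mul, abs_of_pos ha]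
    have := mul_le_mul_of_nonneg_left (h.abs_deriv_le (l * a) (by positivity)) ha.le
    refine this.trans_eq ?_
    field_simp
  calc _ ≤ |a * g' (l * a)| + |b * g' (l * b)| := abs_sub _ _
    _ ≤ B / l + B / l := add_le_add (d a ha) (d b hb)
    _ = _ := by ring

lemma abs_iteratedDeriv_two_dilation_sub_le (h : LogLike g g' g'' c B) {a b l : ℝ} (ha : 0 < a)
    (hb : 0 < b) (hl : 0 < l) :
    |iteratedDeriv 2 (fun s => g (s * a) - g (s * b)) l| ≤ 2 * B / l ^ 2 := by
  have he : deriv (fun s => g (s * a) - g (s * b)) =ᶠ[nhds l]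
      fun s => a * g' (s * a) - b * g' (s * b) := by
    filter_upwards [Ioi_mem_nhds hl] with s hs using (h.hasDerivAt_dilation_sub ha hb hs).deriv
  rw [iteratedDeriv_succ, iteratedDeriv_one, he.deriv_eq,
    (h.hasDerivAt_dilation_sub' ha hb hl).deriv]
  have d : ∀ a, 0 < a → |a ^ 2 * g'' (l * a)| ≤ B / l ^ 2 := fun a ha => by
    rw [abs_mul, abs_of_pos (pow_pos ha 2)]
    have := mul_le_mul_of_nonneg_left (h.abs_deriv2_le (l * a) (by positivity)) (pow_pos ha 2).le
    refine this.trans_eq ?_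
    field_simp
  calc _ ≤ |a ^ 2 * g'' (l * a)| + |b ^ 2 * g'' (l * b)| := abs_sub _ _
    _ ≤ B / l ^ 2 + B / l ^ 2 := add_le_add (d a ha) (d b hb)
    _ = _ := by ring

/-- An integrable majorant of the derivative of a difference of dilations. -/
lemma abs_deriv_dilation_sub_le_indicator (h : LogLike g g' g'' c B) (hB : 0 < B) {a b l : ℝ}
    (ha : 0 < a) (hab : a ≤ b) (hl : 0 < l) :
    |deriv (fun s => g (s * a) - g (s * b)) l| ≤
      (Ioc 0 (1 / b)).indicator (fun _ => 2 * B * b) l +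
        (Ioc (1 / b) (1 / a)).indicator (fun s => 2 * B * s⁻¹) l := by
  have hb := ha.trans_le hab
  have hba : 1 / b ≤ 1 / a := one_div_le_one_div_of_le ha hab
  rcases le_or_gt l (1 / b) with h1 | h1
  · rw [indicator_of_mem (show l ∈ Ioc 0 (1 / b) from ⟨hl, h1⟩),
      indicator_of_notMem (fun hm => absurd hm.1 h1.not_gt), add_zero,
      (h.hasDerivAt_dilation_sub ha hb hl).deriv]
    have ka := h.abs_mul_deriv_sub_le (l * a) (by positivity)
    have kb := h.abs_mul_deriv_sub_le (l * b) (by positivity)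
    have hla : B * (l * a) ≤ B * (l * b) := by gcongr
    have e : l * |a * g' (l * a) - b * g' (l * b)| ≤ l * (2 * B * b) := by
      rw [← abs_of_pos hl, ← abs_mul, abs_of_pos hl]
      calc |l * (a * g' (l * a) - b * g' (l * b))|
          = |(l * a * g' (l * a) - c) - (l * b * g' (l * b) - c)| := by congr 1; ring
        _ ≤ |l * a * g' (l * a) - c| + |l * b * g' (l * b) - c| := abs_sub _ _
        _ ≤ l * (2 * B * b) := by linarith
    exact le_of_mul_le_mul_left e hl
  · rw [indicator_of_notMem (fun hm => absurd hm.2 h1.not_ge), zero_add]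
    rcases le_or_gt l (1 / a) with h2 | h2
    · rw [indicator_of_mem (show l ∈ Ioc (1 / b) (1 / a) from ⟨h1, h2⟩), ← div_eq_mul_inv]
      exact h.abs_deriv_dilation_sub_le ha hb hl
    · rw [indicator_of_notMem (fun hm => absurd hm.2 h2.not_ge),
        (h.hasDerivAt_dilation_sub ha hb hl).deriv, h.deriv_eq_zero _ ((div_lt_iff₀ ha).1 h2),
        h.deriv_eq_zero _ ((div_lt_iff₀ hb).1 h1)]
      simp

lemma exists_integrable_majorant (h : LogLike g g' g'' c B) (hB : 0 < B) {a b : ℝ}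
    (ha : 0 < a) (hb : 0 < b) :
    ∃ G : ℝ → ℝ, Integrable G ∧ (∀ l, 0 ≤ G l) ∧
      (∀ l, 0 < l → |deriv (fun s => g (s * a) - g (s * b)) l| ≤ G l) ∧
      ∫ l, G l = 2 * B * (1 + |Real.log (a / b)|) := by
  wlog hab : a ≤ b generalizing a b
  · obtain ⟨G, h1, h2, h3, h4⟩ := this hb ha (le_of_not_ge hab)
    refine ⟨G, h1, h2, fun l hl => ?_, ?_⟩
    · have : (fun s => g (s * a) - g (s * b)) = -(fun s => g (s * b) - g (s * a)) := by
        ext s; simp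
      rw [this, deriv.neg, abs_neg]
      exact h3 l hl
    · rw [h4, ← inv_div a b, Real.log_inv, abs_neg]
  have hba : 1 / b ≤ 1 / a := one_div_le_one_div_of_le ha hab
  have hb' : 0 < 1 / b := by positivity
  have i1 : Integrable ((Ioc 0 (1 / b)).indicator (fun _ : ℝ => 2 * B * b)) := by
    rw [integrable_indicator_iff measurableSet_Ioc]
    exact integrableOn_const (by simp)
  have hpos : ∀ x ∈ uIcc (1 / b) (1 / a), 0 < x := fun x hx => by
    rw [uIcc_of_le hba] at hx; exact hb'.trans_le hx.1
  have i2 : Integrable ((Ioc (1 / b) (1 / a)).indicator (fun s : ℝ => 2 * B * s⁻¹)) := by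
    rw [integrable_indicator_iff measurableSet_Ioc,
      ← intervalIntegrable_iff_integrableOn_Ioc_of_le hba]
    exact (intervalIntegral.intervalIntegrable_inv (fun x hx => (hpos x hx).ne')
        continuousOn_id).const_mul _
  refine ⟨fun l => _ + _, i1.add i2, fun l => ?_,
    fun l hl => h.abs_deriv_dilation_sub_le_indicator hB ha hab hl, ?_⟩
  · refine add_nonneg (indicator_nonneg (fun _ _ => by positivity) _)
      (indicator_nonneg (fun s hs => ?_) _)
    have : 0 < s := hb'.trans hs.1
    positivity
  · rw [integral_add i1 i2, integral_indicator measurableSet_Ioc,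
      integral_indicator measurableSet_Ioc, ← intervalIntegral.integral_of_le hb'.le,
      ← intervalIntegral.integral_of_le hba, intervalIntegral.integral_const_mul (2 * B) (·⁻¹),
      integral_inv_of_pos hb' (by positivity), intervalIntegral.integral_const,
      ← inv_div b a, Real.log_inv, abs_neg,
      abs_of_nonneg (Real.log_nonneg ((one_le_div ha).2 hab))]
    have e : 1 / a / (1 / b) = b / a := by field_simp
    rw [e, smul_eq_mul]
    field_simp
    ring

end LogLike

lemma logMinus_nonneg (s : ℝ) : 0 ≤ logMinus s := by
  unfold logMinus
  split_ifs with h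
  · linarith [Real.log_neg h.1 h.2]
  · exact le_rfl

lemma logPlus_eq_of_one_le {s : ℝ} (hs : 1 ≤ s) : logPlus s = Real.log s := by
  unfold logPlus
  split_ifs with h
  · rfl
  · rw [le_antisymm (not_lt.1 h) hs, Real.log_one]

lemma neg_log_le_logMinus {s : ℝ} (hs : 0 < s) : -Real.log s ≤ logMinus s := by
  unfold logMinus
  split_ifs with h
  · exact le_rfl
  · linarith [Real.log_nonneg (not_lt.1 fun h1 => h ⟨hs, h1⟩)]

lemma one_le_kker (x x₁ : Plane) : 1 ≤ kker x x₁ := by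
  have h1 := logMinus_nonneg ‖x - x₁‖
  have h2 : 1 ≤ 1 + ‖x₁‖ := by linarith [norm_nonneg x₁]
  have h3 := Real.log_nonneg h2
  rw [kker, logPlus_eq_of_one_le h2]
  linarith

lemma abs_log_div_le_kker {x x₁ : Plane} (hne : x ≠ x₁) :
    |Real.log (‖x - x₁‖ / (‖x‖ + 1))| ≤ kker x x₁ := by
  have hp : 0 < ‖x - x₁‖ := norm_pos_iff.2 (sub_ne_zero.2 hne)
  have hr : 0 < ‖x‖ + 1 := by positivity
  have hq : 0 < 1 + ‖x₁‖ := by positivity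
  have hq1 : 1 ≤ 1 + ‖x₁‖ := by linarith [norm_nonneg x₁]
  have hm := neg_log_le_logMinus hp
  have hm0 := logMinus_nonneg ‖x - x₁‖
  have hlq := Real.log_nonneg hq1
  have ht1 : ‖x - x₁‖ ≤ ‖x‖ + ‖x₁‖ := norm_sub_le _ _
  have ht2 : ‖x‖ ≤ ‖x - x₁‖ + ‖x₁‖ := by
    simpa using norm_add_le (x - x₁) x₁
  rw [kker, logPlus_eq_of_one_le hq1, Real.log_div hp.ne' hr.ne', abs_le]
  constructor
  · have hl2 : Real.log 2 ≤ 1 := by linarith [Real.log_two_lt_d9]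
    rcases le_total 1 ‖x - x₁‖ with h | h
    · have h1 : ‖x‖ + 1 ≤ 2 * (1 + ‖x₁‖) * ‖x - x₁‖ := by
        nlinarith [norm_nonneg x₁]
      have := Real.log_le_log hr h1
      rw [Real.log_mul (by positivity) hp.ne', Real.log_mul two_ne_zero hq.ne'] at this
      linarith
    · have h1 : ‖x‖ + 1 ≤ 2 * (1 + ‖x₁‖) := by linarith [norm_nonneg x₁]
      have := Real.log_le_log hr h1
      rw [Real.log_mul two_ne_zero hq.ne'] at this
      linarith
  · have h1 : ‖x - x₁‖ ≤ (1 + ‖x₁‖) * (‖x‖ + 1) := by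
      nlinarith [norm_nonneg x₁, norm_nonneg x]
    have := Real.log_le_log hp h1
    rw [Real.log_mul hq.ne' hr.ne'] at this
    linarith

/-- Bounds for `F(λ,x,x₁) = χ(λp)Y₀(λp) − χ(λr)Y₀(λr)` with `p = |x−x₁|`,
`r = |x|+1`: `|F| ≲ k(x,x₁)`, `∫₀^{2λ₁}(|F|+|∂_λF|)dλ ≲ k(x,x₁)`, `|∂_λF| ≲ 1/λ`,
`|∂_λ²F| ≲ 1/λ²`. -/
theorem F_difference_bounds
    (χ : ℝ → ℝ) (hχ : ContDiff ℝ (⊤ : ℕ∞) χ)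
    (hχ1 : ∀ s : ℝ, |s| ≤ 1 / 2 → χ s = 1)
    (hχ0 : ∀ s : ℝ, 1 ≤ |s| → χ s = 0)
    (lam1 : ℝ) (hlam1 : lam1 ∈ Set.Ioo (0:ℝ) 1) :
    ∃ C : ℝ, 0 < C ∧ ∀ x x₁ : Plane, x ≠ x₁ →
      (∀ l : ℝ, 0 < l →
        |χ (l * ‖x - x₁‖) * Y0 (l * ‖x - x₁‖) -
            χ (l * (‖x‖ + 1)) * Y0 (l * (‖x‖ + 1))| ≤ C * kker x x₁ ∧
        |deriv (fun s : ℝ => χ (s * ‖x - x₁‖) * Y0 (s * ‖x - x₁‖) -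
            χ (s * (‖x‖ + 1)) * Y0 (s * (‖x‖ + 1))) l| ≤ C / l ∧
        |iteratedDeriv 2 (fun s : ℝ => χ (s * ‖x - x₁‖) * Y0 (s * ‖x - x₁‖) -
            χ (s * (‖x‖ + 1)) * Y0 (s * (‖x‖ + 1))) l| ≤ C / l ^ 2) ∧
      (∫ l in (0:ℝ)..(2 * lam1),
          (|χ (l * ‖x - x₁‖) * Y0 (l * ‖x - x₁‖) -
              χ (l * (‖x‖ + 1)) * Y0 (l * (‖x‖ + 1))| +
            |deriv (fun s : ℝ => χ (s * ‖x - x₁‖) * Y0 (s * ‖x - x₁‖) -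
              χ (s * (‖x‖ + 1)) * Y0 (s * (‖x‖ + 1))) l|)) ≤ C * kker x x₁ := by
  obtain ⟨g', g'', B, hB, h⟩ := exists_logLike_cutoff hχ hχ1 hχ0
  refine ⟨6 * B, by positivity, fun x x₁ hne => ?_⟩
  have hp : 0 < ‖x - x₁‖ := norm_pos_iff.2 (sub_ne_zero.2 hne)
  have hr : 0 < ‖x‖ + 1 := by positivity
  have hk1 := one_le_kker x x₁
  have hlog := abs_log_div_le_kker hne
  have hF : ∀ l : ℝ, 0 < l → |χ (l * ‖x - x₁‖) * Y0 (l * ‖x - x₁‖) -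
      χ (l * (‖x‖ + 1)) * Y0 (l * (‖x‖ + 1))| ≤ B * kker x x₁ := fun l hl => by
    have := h.abs_sub_le (mul_pos hl hp) (mul_pos hl hr)
    rw [mul_div_mul_left _ _ hl.ne'] at this
    exact this.trans (by gcongr)
  refine ⟨fun l hl => ⟨(hF l hl).trans ?_, ?_, ?_⟩, ?_⟩
  · gcongr; linarith
  · refine (h.abs_deriv_dilation_sub_le hp hr hl).trans ?_
    gcongr; linarith
  · refine (h.abs_iteratedDeriv_two_dilation_sub_le hp hr hl).trans ?_
    gcongr; linarith
  · obtain ⟨G, hGi, hG0, hG, hGv⟩ := h.exists_integrable_majorant hB hp hr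
    have h2 : 0 < 2 * lam1 := by linarith [hlam1.1]
    rw [intervalIntegral.integral_of_le h2.le]
    have hci : IntegrableOn (fun _ : ℝ => B * kker x x₁) (Ioc 0 (2 * lam1)) :=
      integrableOn_const measure_Ioc_lt_top.ne
    refine (integral_mono_of_nonneg (Eventually.of_forall fun l => by positivity)
      (hci.add hGi.integrableOn) ?_).trans ?_
    · filter_upwards [ae_restrict_mem measurableSet_Ioc] with l hl
      exact add_le_add (hF l hl.1) (hG l hl.1)
    · simp only [Pi.add_apply]
      rw [integral_add hci hGi.integrableOn]
      have hGle : ∫ l in Ioc 0 (2 * lam1), G l ≤ ∫ l, G l :=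
        setIntegral_le_integral hGi (Eventually.of_forall hG0)
      have hc : ∫ _ in Ioc 0 (2 * lam1), B * kker x x₁ ≤ 2 * (B * kker x x₁) := by
        rw [← intervalIntegral.integral_of_le h2.le, intervalIntegral.integral_const, smul_eq_mul]
        have := hlam1.2
        gcongr
        linarith
      rw [hGv] at hGle
      nlinarith
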